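/- arXiv:1411.4410 — 2 statements merged into one kernel-verified Lean document; each statement's English description precedes it below -/
import Mathlib

section
/- Over the ring ℤ of integers, the fracpairs (1, 1) and (2, 2) are not cc-equivalent. (Hence the canonical surjection from cc-fractions over ℤ onto the rationals with totalized inverse is not injective.) -/
/-- One step of the common cancellation relation CC:
`(x*z, y*(z*z))` is related to `(x, y*z)`. -/
def CC (a b : ℤ × ℤ) : Prop :=
  ∃ x y z : ℤ, a = (x * z, y * (z * z)) ∧ b = (x, y * z)

/-- cc-equivalence: the smallest equivalence relation containing all instances of CC. -/
def ccEq (a b : ℤ × ℤ) : Prop :=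
  Relation.EqvGen CC a b

/-- Being a pair `(u, u)` with `u` a unit is invariant under common cancellation. -/
theorem CC.eq_and_isUnit_iff {a b : ℤ × ℤ} (h : CC a b) :
    (a.1 = a.2 ∧ IsUnit a.1) ↔ (b.1 = b.2 ∧ IsUnit b.1) := by
  obtain ⟨x, y, z, rfl, rfl⟩ := h
  dsimp only
  constructor
  · rintro ⟨h, hu⟩
    obtain ⟨hx, hz⟩ := IsUnit.mul_iff.mp hu
    exact ⟨mul_right_cancel₀ hz.ne_zero (h.trans (mul_assoc y z z).symm), hx⟩
  · rintro ⟨rfl, hu⟩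
    exact ⟨mul_assoc y z z, hu.mul (IsUnit.mul_iff.mp hu).2⟩

theorem ccEq.eq_and_isUnit_iff {a b : ℤ × ℤ} (h : ccEq a b) :
    (a.1 = a.2 ∧ IsUnit a.1) ↔ (b.1 = b.2 ∧ IsUnit b.1) := by
  induction h with
  | rel _ _ h => exact h.eq_and_isUnit_iff
  | refl _ => exact Iff.rfl
  | symm _ _ _ ih => exact ih.symm
  | trans _ _ _ _ _ ih₁ ih₂ => exact ih₁.trans ih₂

theorem stmt12 : ¬ ccEq ((1, 1) : ℤ × ℤ) (2, 2) := by
  intro h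
  have h2 := (h.eq_and_isUnit_iff.mp ⟨rfl, isUnit_one⟩).2
  simp [Int.isUnit_iff] at h2
end

section
/- Over the ring ℤ of integers, for every prime number p and all integers c, d, the fracpairs (c·p, d·p) and (c, d) are rf-equivalent: (c·p, d·p) =rf (c, d). -/
/-- One step of the rational fracpair relation RF:
`(x*((z*z + u*u) + 1), y*((z*z + u*u) + 1))` is related to `(x, y)`. -/
def RF (a b : ℤ × ℤ) : Prop :=
  ∃ x y z u : ℤ, a = (x * ((z * z + u * u) + 1), y * ((z * z + u * u) + 1)) ∧
    b = (x, y)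

/-- rf-equivalence: the smallest equivalence relation containing all instances
of CC and of RF. -/
def rfEq (a b : ℤ × ℤ) : Prop :=
  Relation.EqvGen (fun a b => CC a b ∨ RF a b) a b

/-- Over `ℤ`, every positive common factor can be cancelled up to rf-equivalence. -/
theorem rfEq_mul_right_of_pos (n : ℕ) (hn : 0 < n) (c d : ℤ) :
    rfEq (c * (n : ℤ), d * (n : ℤ)) (c, d) := by
  induction n using Nat.strong_induction_on generalizing c d with
  | _ n ih =>
    by_cases hp : n.Prime
    · have : Fact n.Prime := ⟨hp⟩
      obtain ⟨a, b, k, hk0, hlt, hk⟩ := Int.exists_sq_add_sq_add_one_eq_mul n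
      have hz : ((a : ℤ) * a + b * b) + 1 = n * k := by
        have : (a : ℤ) ^ 2 + (b : ℤ) ^ 2 + 1 = k * n := by exact_mod_cast hk
        linarith
      refine .trans _ _ _ (.symm _ _ (ih k hlt hk0 _ _)) (.rel _ _ (.inr ⟨c, d, a, b, ?_, rfl⟩))
      rw [hz, mul_assoc, mul_assoc]
    · rcases Nat.lt_or_ge n 2 with h | h
      · obtain rfl : n = 1 := by omega
        simp only [Nat.cast_one, mul_one]
        exact .refl _
      · obtain ⟨a, b, ha, hb, rfl⟩ := (Nat.not_prime_iff_exists_mul_eq h).mp hp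
        have h1 := ih b hb (Nat.pos_of_mul_pos_left hn) (c * a) (d * a)
        have h2 := ih a ha (Nat.pos_of_mul_pos_right hn) c d
        rw [Nat.cast_mul, ← mul_assoc, ← mul_assoc]
        exact .trans _ _ _ h1 h2

theorem stmt19 (p : ℕ) (hp : p.Prime) (c d : ℤ) :
    rfEq (c * (p : ℤ), d * (p : ℤ)) (c, d) :=
  rfEq_mul_right_of_pos p hp.pos c d
end
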